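/- arXiv:0908.3681 — 3 statements merged into one kernel-verified Lean document; each statement's English description precedes it below -/
import Mathlib

section
/- Let m ≥ 1, let L and R be the m×m cyclic shift matrices over ℂ, let λ : ZMod m → ℂ be nonvanishing, and let Λ, Ω, K be as defined. Then (L − Λ)(R − Λ) = −ΛK − ΩL = −KΛ − RΩ, and (R − Λ)(L − Λ) = −KΛ + ΩL. -/
/-- With `L`, `R` the `m×m` cyclic shift matrices, `Λ` the diagonal matrix
of a nonvanishing `λ`, `Ω` the diagonal matrix of `ω_n = λ_{n+1} - λ_n`, and
`K = L + R - Λ - Λ⁻¹`, we have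
`(L − Λ)(R − Λ) = −ΛK − ΩL = −KΛ − RΩ` and `(R − Λ)(L − Λ) = −KΛ + ΩL`. -/
theorem statement0 (m : ℕ) (hm : 1 ≤ m) [NeZero m]
    (lam : ZMod m → ℂ) (hlam : ∀ n, lam n ≠ 0)
    (L R Λ Ω K : Matrix (ZMod m) (ZMod m) ℂ)
    (hL : ∀ i j, L i j = if j = i + 1 then 1 else 0)
    (hR : ∀ i j, R i j = if j = i - 1 then 1 else 0)
    (hΛ : Λ = Matrix.diagonal lam)
    (hΩ : Ω = Matrix.diagonal (fun n => lam (n + 1) - lam n))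
    (hK : K = L + R - Λ - Λ⁻¹) :
    (L - Λ) * (R - Λ) = -(Λ * K) - Ω * L ∧
    (L - Λ) * (R - Λ) = -(K * Λ) - R * Ω ∧
    (R - Λ) * (L - Λ) = -(K * Λ) + Ω * L := by
  have hLR : L * R = 1 := by
    ext i j
    rw [Matrix.mul_apply, Finset.sum_eq_single (i + 1)]
    · simp [hL, hR, Matrix.one_apply, eq_comm (a := i)]
    · intro x _ hx
      simp [hL, hR, hx]
    · simp
  have hRL : R * L = 1 := by
    ext i j
    rw [Matrix.mul_apply, Finset.sum_eq_single (i - 1)]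
    · simp [hL, hR, Matrix.one_apply, eq_comm (a := i)]
    · intro x _ hx
      simp [hL, hR, hx]
    · simp
  have hdet : IsUnit Λ.det := by
    rw [hΛ, Matrix.det_diagonal]
    exact (Finset.prod_ne_zero_iff.2 fun n _ => hlam n).isUnit
  have hinv : Λ * Λ⁻¹ = 1 := Matrix.mul_nonsing_inv Λ hdet
  have hinv' : Λ⁻¹ * Λ = 1 := Matrix.nonsing_inv_mul Λ hdet
  have hΩL : Ω * L = L * Λ - Λ * L := by
    ext i j
    by_cases h : j = i + 1 <;> simp [hΛ, hΩ, hL, h]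
  have hRΩ : R * Ω = Λ * R - R * Λ := by
    ext i j
    by_cases h : j = i - 1 <;> simp [hΛ, hΩ, hR, h]
  rw [hΩL, hRΩ, hK]
  simp only [mul_sub, sub_mul, mul_add, add_mul, hLR, hRL, hinv, hinv']
  refine ⟨?_, ?_, ?_⟩ <;> abel
end

section
/- For every c > 0 and every R₀ > 1 there exists a constant C > 0 such that for all real r with 1 < r ≤ R₀ and all real υ ≥ 0: Σ_{j=0}^{∞} r^{−j}·exp( c·υ·√j ) ≤ (C/ln r)·exp( C·υ²/ln r ). -/
/-- The geometric series of ratio `exp (-x)` is at most `(1 + x) / x`. -/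
theorem inv_one_sub_exp_neg_le {x : ℝ} (hx : 0 < x) :
    (1 - Real.exp (-x))⁻¹ ≤ (1 + x) / x := by
  have h : Real.exp (-x) ≤ (1 + x)⁻¹ := by
    rw [Real.exp_neg]
    exact inv_anti₀ (by positivity) (by linarith [Real.add_one_le_exp x])
  rw [← inv_div]
  refine inv_anti₀ (by positivity) ?_
  have : x / (1 + x) = 1 - (1 + x)⁻¹ := by field_simp; ring
  linarith

/-- Completing the square absorbs `a √j` into half of the linear decay `L j`. -/
theorem mul_sqrt_le_half_mul_add {L : ℝ} (hL : 0 < L) (a : ℝ) (j : ℕ) :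
    a * Real.sqrt j ≤ L / 2 * j + a ^ 2 / (2 * L) := by
  have hs : Real.sqrt j ^ 2 = j := Real.sq_sqrt (Nat.cast_nonneg j)
  have h : L / 2 * j + a ^ 2 / (2 * L) - a * Real.sqrt j
      = (L * Real.sqrt j - a) ^ 2 / (2 * L) := by
    field_simp
    linear_combination -L ^ 2 * hs
  have : 0 ≤ (L * Real.sqrt j - a) ^ 2 / (2 * L) := by positivity
  linarith

/-- Each term is dominated by a term of a geometric series of ratio `exp (-(log r / 2))`. -/
theorem zpow_neg_mul_exp_mul_sqrt_le {r : ℝ} (hr : 1 < r) (a : ℝ) (j : ℕ) :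
    r ^ (-(j : ℤ)) * Real.exp (a * Real.sqrt j)
      ≤ Real.exp (-(Real.log r / 2)) ^ j * Real.exp (a ^ 2 / (2 * Real.log r)) := by
  have hpow : r ^ (-(j : ℤ)) = Real.exp (-(j * Real.log r)) := by
    rw [zpow_neg, zpow_natCast, Real.exp_neg, Real.exp_nat_mul, Real.exp_log (by linarith)]
  rw [hpow, ← Real.exp_nat_mul, ← Real.exp_add, ← Real.exp_add, Real.exp_le_exp]
  linarith [mul_sqrt_le_half_mul_add (Real.log_pos hr) a j]

/-- for `1 < r ≤ R₀` and `υ ≥ 0`,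
`Σ_{j≥0} r^{−j} exp(cυ√j) ≤ (C/ln r) · exp(Cυ²/ln r)` with `C = C(c, R₀)`. -/
theorem statement12 (c R₀ : ℝ) (hc : 0 < c) (hR₀ : 1 < R₀) :
    ∃ C > (0 : ℝ), ∀ r : ℝ, 1 < r → r ≤ R₀ → ∀ υ : ℝ, 0 ≤ υ →
      ∑' j : ℕ, r ^ (-(j : ℤ)) * Real.exp (c * υ * Real.sqrt j)
        ≤ (C / Real.log r) * Real.exp (C * υ ^ 2 / Real.log r) := by
  have hLR : 0 < Real.log R₀ := Real.log_pos hR₀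
  refine ⟨2 + Real.log R₀ + c ^ 2 / 2, by positivity, fun r hr hrR υ _ => ?_⟩
  have hL : 0 < Real.log r := Real.log_pos hr
  have hLle : Real.log r ≤ Real.log R₀ := Real.log_le_log (by linarith) hrR
  have hq : Real.exp (-(Real.log r / 2)) < 1 := by
    rw [Real.exp_lt_one_iff]
    linarith
  have hbound := zpow_neg_mul_exp_mul_sqrt_le hr (c * υ)
  have hgeom := (summable_geometric_of_lt_one (Real.exp_nonneg _) hq).mul_right
    (Real.exp ((c * υ) ^ 2 / (2 * Real.log r)))
  have hsum := Summable.of_nonneg_of_le (fun j => by positivity) hbound hgeom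
  refine (hsum.tsum_le_tsum hbound hgeom).trans ?_
  rw [tsum_mul_right, tsum_geometric_of_lt_one (Real.exp_nonneg _) hq]
  have hcoef : (1 - Real.exp (-(Real.log r / 2)))⁻¹
      ≤ (2 + Real.log R₀ + c ^ 2 / 2) / Real.log r := by
    refine (inv_one_sub_exp_neg_le (half_pos hL)).trans ?_
    rw [show (1 + Real.log r / 2) / (Real.log r / 2) = (2 + Real.log r) / Real.log r by
      field_simp]
    exact div_le_div_of_nonneg_right (by linarith [sq_nonneg c]) hL.le
  have hexp : (c * υ) ^ 2 / (2 * Real.log r)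
      ≤ (2 + Real.log R₀ + c ^ 2 / 2) * υ ^ 2 / Real.log r := by
    rw [show (c * υ) ^ 2 / (2 * Real.log r) = c ^ 2 / 2 * υ ^ 2 / Real.log r by
      field_simp]
    gcongr
    linarith
  exact mul_le_mul hcoef (Real.exp_le_exp.mpr hexp) (Real.exp_nonneg _) (by positivity)
end

section
/- Let f be harmonic on Π and continuous on the closure of Π. Suppose |f(z)| ≤ γ for all z in the closure of Π, and f(x) = 0 for every real x ∈ [a, b]. Then for each δ with 0 < δ < (b − a)/2 there exists a constant C > 0, depending only on a, b, c and δ (not on f or γ), such that |f(z)| ≤ C·γ·Im z for all z ∈ Π with a + δ < Re z < b − δ. -/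
/-- The open rectangle `Π = {z : a < Re z < b, 0 < Im z < c}`. -/
def rectangle (a b c : ℝ) : Set ℂ :=
  {z : ℂ | a < z.re ∧ z.re < b ∧ 0 < z.im ∧ z.im < c}

/-- `f : ℂ → ℝ` is harmonic on `s`: twice continuously differentiable with
`Δf = f_xx + f_yy = 0` on `s`. -/
def IsHarmonicOn (f : ℂ → ℝ) (s : Set ℂ) : Prop :=
  ContDiffOn ℝ 2 f s ∧
  ∀ z ∈ s, fderiv ℝ (fun w => fderiv ℝ f w 1) z 1 +
    fderiv ℝ (fun w => fderiv ℝ f w Complex.I) z Complex.I = 0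

open Filter Topology

theorem rectangle_eq_reProdIm (a b c : ℝ) :
    rectangle a b c = Set.Ioo a b ×ℂ Set.Ioo 0 c := by
  ext z
  simp [rectangle, Complex.mem_reProdIm, and_assoc]

theorem isOpen_rectangle (a b c : ℝ) : IsOpen (rectangle a b c) := by
  rw [rectangle_eq_reProdIm]
  exact isOpen_Ioo.reProdIm isOpen_Ioo

theorem closure_rectangle {a b c : ℝ} (hab : a < b) (hc : 0 < c) :
    closure (rectangle a b c) = Set.Icc a b ×ℂ Set.Icc 0 c := by
  rw [rectangle_eq_reProdIm, Complex.closure_reProdIm, closure_Ioo hab.ne, closure_Ioo hc.ne]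

theorem IsHarmonicOn.neg {f : ℂ → ℝ} {s : Set ℂ} (hf : IsHarmonicOn f s) :
    IsHarmonicOn (fun z => -f z) s := by
  refine ⟨hf.1.neg, fun z hz => ?_⟩
  have h := hf.2 z hz
  simp only [fderiv_fun_neg, neg_apply]
  linarith

/-- The second derivative is nonpositive at a local maximum. -/
theorem IsLocalMax.deriv_deriv_nonpos {g : ℝ → ℝ} {x : ℝ} (h : IsLocalMax g x)
    (hg : ContinuousAt g x) : deriv (deriv g) x ≤ 0 := by
  by_contra! hpos
  have hmin := isLocalMin_of_deriv_deriv_pos hpos h.deriv_eq_zero hg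
  have hconst : g =ᶠ[𝓝 x] fun _ => g x := by
    filter_upwards [h, hmin] with y h₁ h₂ using le_antisymm h₁ h₂
  have h₀ := hconst.deriv.deriv_eq
  simp at h₀
  linarith

/-- If subtracting a quadratic polynomial from `f` along a line through `z` gives a local maximum
at `z`, then the second directional derivative of `f` is at most that of the polynomial. -/
theorem fderiv_fderiv_apply_le_of_isLocalMax {f : ℂ → ℝ} {z v : ℂ} {α β κ : ℝ}
    (hf : ContDiffAt ℝ 2 f z)
    (hmax : IsLocalMax (fun t : ℝ => f (z + t • v) - (α * t ^ 2 + β * t + κ)) 0) :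
    fderiv ℝ (fun w => fderiv ℝ f w v) z v ≤ 2 * α := by
  have hline (t : ℝ) : HasDerivAt (fun t : ℝ => z + t • v) v t := by
    simpa using ((hasDerivAt_id t).smul_const v).const_add z
  have hlim : Tendsto (fun t : ℝ => z + t • v) (𝓝 0) (𝓝 z) := by
    simpa using (hline 0).continuousAt.tendsto
  have hfirst : ∀ᶠ t : ℝ in 𝓝 0,
      HasDerivAt (fun t : ℝ => f (z + t • v) - (α * t ^ 2 + β * t + κ))
        (fderiv ℝ f (z + t • v) v - (2 * α * t + β)) t := by
    filter_upwards [hlim.eventually (hf.eventually (by simp))] with t ht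
    have hfd := (ht.differentiableAt (by simp)).hasFDerivAt.comp_hasDerivAt t (hline t)
    have hq : HasDerivAt (fun t : ℝ => α * t ^ 2 + β * t + κ) (2 * α * t + β) t := by
      exact ((((hasDerivAt_id t).pow 2).const_mul α).add
        ((hasDerivAt_id t).const_mul β)).add_const κ |>.congr_deriv (by simp; ring)
    exact hfd.sub hq
  have hdiff : DifferentiableAt ℝ (fun w => fderiv ℝ f w v) z :=
    ((hf.fderiv_right (m := 1) (by norm_num)).differentiableAt (by simp)).clm_apply
      (differentiableAt_const v)
  have hz : z + (0 : ℝ) • v = z := by simp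
  have hsecond : HasDerivAt (fun t : ℝ => fderiv ℝ f (z + t • v) v - (2 * α * t + β))
      (fderiv ℝ (fun w => fderiv ℝ f w v) z v - 2 * α) 0 := by
    have hfd := HasFDerivAt.comp_hasDerivAt (x := (0 : ℝ)) (f := fun t : ℝ => z + t • v)
      (l := fun w => fderiv ℝ f w v) (hl := by rw [hz]; exact hdiff.hasFDerivAt) (hf := hline 0)
    have hq : HasDerivAt (fun t : ℝ => 2 * α * t + β) (2 * α) 0 := by
      simpa using ((hasDerivAt_id (0 : ℝ)).const_mul (2 * α)).add_const β
    exact hfd.sub hq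
  have hderiv : deriv (fun t : ℝ => f (z + t • v) - (α * t ^ 2 + β * t + κ)) =ᶠ[𝓝 0]
      fun t => fderiv ℝ f (z + t • v) v - (2 * α * t + β) :=
    hfirst.mono fun t ht => ht.deriv
  have hle := hmax.deriv_deriv_nonpos hfirst.self_of_nhds.continuousAt
  rw [hderiv.deriv_eq, hsecond.deriv] at hle
  linarith

/-- One-sided boundary estimate, by comparison with the strictly superharmonic barrier
`γ ((x - x₀)² / δ² + (2c / δ² + 1 / c) y - 2 y² / δ²)`. -/
theorem IsHarmonicOn.le_mul_im {a b c δ γ : ℝ} {f : ℂ → ℝ} (hab : a < b) (hc : 0 < c)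
    (hδ : 0 < δ) (hγ : 0 < γ) (hf : IsHarmonicOn f (rectangle a b c))
    (hcont : ContinuousOn f (closure (rectangle a b c)))
    (hbound : ∀ z ∈ closure (rectangle a b c), f z ≤ γ)
    (hzero : ∀ x : ℝ, x ∈ Set.Icc a b → f (x : ℂ) = 0) {z₀ : ℂ}
    (hz₀ : z₀ ∈ rectangle a b c) (hleft : a + δ < z₀.re) (hright : z₀.re < b - δ) :
    f z₀ ≤ (2 / δ ^ 2 * c + 1 / c) * γ * z₀.im := by
  obtain ⟨-, -, hy0, hyc⟩ := hz₀
  set x₀ := z₀.re with hx₀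
  set A : ℝ := 2 / δ ^ 2 * c + 1 / c with hA
  set D : ℝ := 1 / δ ^ 2 with hD
  have hDpos : 0 < D := by positivity
  have hDδ : D * δ ^ 2 = 1 := by rw [hD]; field_simp
  have hA' : A = 2 * D * c + 1 / c := by rw [hA, hD]; ring
  let w : ℂ → ℝ := fun z => γ * (D * (z.re - x₀) ^ 2 + A * z.im - 2 * D * z.im ^ 2)
  have hwcont : Continuous w := by fun_prop
  let K : Set ℂ := Set.Icc (x₀ - δ) (x₀ + δ) ×ℂ Set.Icc 0 c
  have hKcl : K ⊆ closure (rectangle a b c) := by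
    rw [closure_rectangle hab hc]
    rintro z ⟨⟨h₁, h₂⟩, h₃⟩
    exact ⟨⟨by linarith, by linarith⟩, h₃⟩
  have hK : IsCompact K := isCompact_Icc.reProdIm isCompact_Icc
  have hz₀K : z₀ ∈ K := ⟨⟨by linarith, by linarith⟩, hy0.le, hyc.le⟩
  obtain ⟨z, hzK, hzmax⟩ := hK.exists_isMaxOn ⟨z₀, hz₀K⟩
    ((hcont.mono hKcl).sub hwcont.continuousOn)
  suffices h : f z - w z ≤ 0 by
    have h₁ : f z₀ - w z₀ ≤ f z - w z := hzmax hz₀K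
    have h₂ : w z₀ = A * γ * z₀.im - γ * (2 * D * z₀.im ^ 2) := by
      simp only [w, ← hx₀]; ring
    have h₃ : 0 ≤ γ * (2 * D * z₀.im ^ 2) := by positivity
    linarith
  obtain ⟨⟨hxl, hxr⟩, hyl, hyr⟩ := id hzK
  have hw : w z = γ * (D * (z.re - x₀) ^ 2 + 2 * D * (z.im * (c - z.im)) + z.im / c) := by
    simp only [w, hA']; ring
  have hyy : 0 ≤ z.im * (c - z.im) := mul_nonneg hyl (by linarith)
  have hyd : 0 ≤ z.im / c := by positivity
  have hxx : 0 ≤ D * (z.re - x₀) ^ 2 := by positivity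
  have hDyy : 0 ≤ 2 * D * (z.im * (c - z.im)) := by positivity
  have hfγ : f z ≤ γ := hbound z (hKcl hzK)
  have hboundary : 1 ≤ D * (z.re - x₀) ^ 2 + 2 * D * (z.im * (c - z.im)) + z.im / c →
      f z - w z ≤ 0 := fun h => by
    rw [hw]
    nlinarith
  rcases hyl.eq_or_lt with hy | hy
  · have hfz : f z = 0 := by
      have hz : z = (z.re : ℂ) := Complex.ext rfl (by simp [← hy])
      rw [hz]
      exact hzero _ ⟨by linarith, by linarith⟩
    have : 0 ≤ w z := by rw [hw]; positivity
    linarith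
  rcases hyr.eq_or_lt with hy' | hy'
  · refine hboundary ?_
    have : z.im / c = 1 := by rw [hy']; field_simp
    linarith
  rcases hxl.eq_or_lt with hx | hx
  · refine hboundary ?_
    have : D * (z.re - x₀) ^ 2 = 1 := by rw [← hx, ← hDδ]; ring
    linarith
  rcases hxr.eq_or_lt with hx' | hx'
  · refine hboundary ?_
    have : D * (z.re - x₀) ^ 2 = 1 := by rw [hx', ← hDδ]; ring
    linarith
  exfalso
  have hzR : z ∈ rectangle a b c := ⟨by linarith, by linarith, hy, hy'⟩
  have hnhds : K ∈ 𝓝 z := by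
    refine mem_of_superset ((isOpen_rectangle (x₀ - δ) (x₀ + δ) c).mem_nhds ⟨hx, hx', hy, hy'⟩) ?_
    rintro u ⟨h₁, h₂, h₃, h₄⟩
    exact ⟨⟨h₁.le, h₂.le⟩, h₃.le, h₄.le⟩
  have hmax : IsLocalMax (fun u => f u - w u) z := hzmax.isLocalMax hnhds
  have hmaxline (v : ℂ) : IsLocalMax (fun t : ℝ => f (z + t • v) - w (z + t • v)) 0 := by
    have hlim : Tendsto (fun t : ℝ => z + t • v) (𝓝 0) (𝓝 z) := by
      have : Continuous fun t : ℝ => z + t • v := by fun_prop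
      simpa using this.tendsto 0
    filter_upwards [hlim.eventually hmax] with t ht
    simpa using ht
  have hfz : ContDiffAt ℝ 2 f z := hf.1.contDiffAt ((isOpen_rectangle a b c).mem_nhds hzR)
  have h₁ := fderiv_fderiv_apply_le_of_isLocalMax (v := 1) (α := γ * D)
    (β := 2 * γ * D * (z.re - x₀)) (κ := w z) hfz (by
      convert hmaxline 1 using 3 with t
      simp [w]
      ring)
  have h₂ := fderiv_fderiv_apply_le_of_isLocalMax (v := Complex.I) (α := -(2 * γ * D))
    (β := γ * (A - 4 * D * z.im)) (κ := w z) hfz (by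
      convert hmaxline Complex.I using 3 with t
      simp [w]
      ring)
  have h₃ := hf.2 z hzR
  have : 0 < γ * D := mul_pos hγ hDpos
  linarith

/-- a harmonic function on the rectangle `Π`, continuous on its closure,
bounded by `γ`, and vanishing on `[a, b]`, satisfies `|f(z)| ≤ C·γ·Im z` away from the
vertical edges, with `C = C(a, b, c, δ)`. -/
theorem statement14 (a b c δ : ℝ) (hab : a < b) (hc : 0 < c)
    (hδ : 0 < δ) (hδ2 : δ < (b - a) / 2) :
    ∃ C > (0 : ℝ), ∀ (f : ℂ → ℝ) (γ : ℝ),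
      IsHarmonicOn f (rectangle a b c) →
      ContinuousOn f (closure (rectangle a b c)) →
      (∀ z ∈ closure (rectangle a b c), |f z| ≤ γ) →
      (∀ x : ℝ, x ∈ Set.Icc a b → f (x : ℂ) = 0) →
      ∀ z ∈ rectangle a b c, a + δ < z.re → z.re < b - δ →
        |f z| ≤ C * γ * z.im := by
  refine ⟨2 / δ ^ 2 * c + 1 / c, by positivity, fun f γ hf hcont hbound hzero z hz hl hr => ?_⟩
  have hfz := hbound z (subset_closure hz)
  rcases ((abs_nonneg _).trans hfz).eq_or_lt with rfl | hγ
  · simpa using hfz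
  refine abs_le'.2 ⟨hf.le_mul_im hab hc hδ hγ hcont
    (fun u hu => (le_abs_self _).trans (hbound u hu)) hzero hz hl hr, ?_⟩
  exact hf.neg.le_mul_im hab hc hδ hγ hcont.neg
    (fun u hu => (neg_le_abs _).trans (hbound u hu)) (fun x hx => by simp [hzero x hx]) hz hl hr
end
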